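/- arXiv:1612.09476 — 2 statements merged into one kernel-verified Lean document; each statement's English description precedes it below -/
import Mathlib

section
/- For all integers 1 ≤ i < M and m ≥ 1: |ℬ₊(mϖ_i)|² = |ℬ₊((m+1)ϖ_i)|·|ℬ₊((m−1)ϖ_i)| + |ℬ₊(mϖ_{i−1})|·|ℬ₊(mϖ_{i+1})| (all these sets are finite). This is the combinatorial form of the T-system dimension identity (d_m^{(i)})² = d_{m+1}^{(i)}d_{m−1}^{(i)} + d_m^{(i−1)}d_m^{(i+1)} satisfied by the dimensions of Kirillov–Reshetikhin modules, since the q-characters of these modules are multiplicity-free sums over ℬ₊-tableaux. -/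
namespace QAS

/-- the Young diagram `Y₊^λ ⊂ ℤ_{>0}²` (in `ℕ × ℕ`; coordinates of `λ` are 1-based). -/
def Yp (M N : ℕ) (lam : ℕ → ℕ) : Set (ℕ × ℕ) :=
  {p | 1 ≤ p.1 ∧ 1 ≤ p.2 ∧
    ((p.1 ≤ M ∧ p.2 ≤ lam p.1) ∨ (M < p.1 ∧ p.2 ≤ N ∧ p.1 ≤ M + lam (M + p.2)))}

/-- the set of Benkart–Kang–Kashiwara tableaux `ℬ₊(λ)`, encoded as functions
`ℕ × ℕ → ℕ` vanishing off `Y₊^λ` and with values in `{1,…,M+N}` on `Y₊^λ`. -/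
def Bpos (M N : ℕ) (lam : ℕ → ℕ) : Set (ℕ × ℕ → ℕ) :=
  {T | (∀ p, p ∉ Yp M N lam → T p = 0) ∧
    (∀ p ∈ Yp M N lam, 1 ≤ T p ∧ T p ≤ M + N) ∧
    (∀ p ∈ Yp M N lam, ∀ p' ∈ Yp M N lam, p.1 ≤ p'.1 → p.2 ≤ p'.2 → T p ≤ T p') ∧
    (∀ p ∈ Yp M N lam, (p.1 + 1, p.2) ∈ Yp M N lam → T p ≤ M → T p < T (p.1 + 1, p.2)) ∧
    (∀ p ∈ Yp M N lam, (p.1, p.2 + 1) ∈ Yp M N lam → M < T p → T p < T (p.1, p.2 + 1))}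

/-- `mϖ_j`: the element of `𝒫` whose first `j` coordinates equal `m` and whose
remaining coordinates are `0`. -/
def wt (j m : ℕ) : ℕ → ℕ := fun k => if 1 ≤ k ∧ k ≤ j then m else 0

/-- Jacobi's identity for complementary minors of a block matrix, multiplied by the determinant. -/
theorem det_mul_det_adjugate_toBlocks₂₂ {m n R : Type*} [Fintype m] [Fintype n] [DecidableEq m]
    [DecidableEq n] [CommRing R] (A : Matrix (m ⊕ n) (m ⊕ n) R) :
    A.det * A.adjugate.toBlocks₂₂.det = A.toBlocks₁₁.det * A.det ^ Fintype.card n := by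
  have hblock : A * Matrix.fromBlocks 1 A.adjugate.toBlocks₁₂ 0 A.adjugate.toBlocks₂₂ =
      Matrix.fromBlocks A.toBlocks₁₁ 0 A.toBlocks₂₁ (A.det • 1) := by
    have h := A.mul_adjugate
    generalize A.adjugate = B at h ⊢
    generalize A.det = d at h ⊢
    rw [← A.fromBlocks_toBlocks, ← B.fromBlocks_toBlocks, Matrix.fromBlocks_multiply,
      ← Matrix.fromBlocks_one, Matrix.fromBlocks_smul, Matrix.fromBlocks_inj] at h
    conv_lhs => rw [← A.fromBlocks_toBlocks]
    rw [Matrix.fromBlocks_multiply]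
    simp [h.2.1, h.2.2.2]
  have := congrArg Matrix.det hblock
  rw [Matrix.det_mul, Matrix.det_fromBlocks_zero₂₁, Matrix.det_fromBlocks_zero₁₂, Matrix.det_one,
    one_mul, Matrix.det_smul, Matrix.det_one, mul_one] at this
  exact this

/-- The interior indices of `Fin (n + 2)` together with its two extreme indices. -/
noncomputable def interiorSumEnds (n : ℕ) : Fin n ⊕ Fin 2 ≃ Fin (n + 2) :=
  Equiv.ofBijective (Sum.elim (fun i => i.castSucc.succ) ![0, Fin.last (n + 1)]) <| by
    rw [Fintype.bijective_iff_injective_and_card]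
    refine ⟨?_, by simp⟩
    rintro (a | a) (b | b) h
    · simpa using h
    · fin_cases b <;> simp [Fin.ext_iff] at h; omega
    · fin_cases a <;> simp [Fin.ext_iff] at h; omega
    · fin_cases a <;> fin_cases b <;> simp_all [Fin.ext_iff]

theorem desnanot_jacobi_of_isLeftRegular {n : ℕ} {R : Type*} [CommRing R]
    (A : Matrix (Fin (n + 2)) (Fin (n + 2)) R) (hA : IsLeftRegular A.det) :
    A.det * (A.submatrix (fun i : Fin n => i.castSucc.succ) (fun i => i.castSucc.succ)).det =
      (A.submatrix Fin.castSucc Fin.castSucc).det * (A.submatrix Fin.succ Fin.succ).det -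
        (A.submatrix Fin.castSucc Fin.succ).det * (A.submatrix Fin.succ Fin.castSucc).det := by
  have h := det_mul_det_adjugate_toBlocks₂₂ (A.submatrix (interiorSumEnds n) (interiorSumEnds n))
  rw [Matrix.adjugate_submatrix_equiv_self, Matrix.det_submatrix_equiv_self, Matrix.det_fin_two,
    Fintype.card_fin, sq, mul_left_comm] at h
  have h' := hA h
  have hint : (A.submatrix (interiorSumEnds n) (interiorSumEnds n)).toBlocks₁₁ =
      A.submatrix (fun i : Fin n => i.castSucc.succ) (fun i => i.castSucc.succ) := rfl
  have h0 : interiorSumEnds n (Sum.inr 0) = 0 := rfl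
  have h1 : interiorSumEnds n (Sum.inr 1) = Fin.last (n + 1) := rfl
  simp only [Matrix.toBlocks₂₂, Matrix.of_apply, Matrix.submatrix_apply, h0, h1,
    Matrix.adjugate_fin_succ_eq_det_submatrix, hint, Fin.succAbove_zero, Fin.succAbove_last,
    Fin.val_zero, Fin.val_last] at h'
  have hs : ((-1 : R) ^ (n + 1)) * (-1) ^ (n + 1) = 1 := by
    rw [← mul_pow]; simp
  rw [mul_comm, ← h']
  simp only [zero_add, add_zero, pow_add _ (n + 1) (n + 1), hs, pow_zero]
  linear_combination (-(A.submatrix Fin.castSucc Fin.succ).det *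
    (A.submatrix Fin.succ Fin.castSucc).det) * hs

/-- The Desnanot–Jacobi identity (Dodgson condensation). -/
theorem desnanot_jacobi {n : ℕ} {R : Type*} [CommRing R]
    (A : Matrix (Fin (n + 2)) (Fin (n + 2)) R) :
    A.det * (A.submatrix (fun i : Fin n => i.castSucc.succ) (fun i => i.castSucc.succ)).det =
      (A.submatrix Fin.castSucc Fin.castSucc).det * (A.submatrix Fin.succ Fin.succ).det -
        (A.submatrix Fin.castSucc Fin.succ).det * (A.submatrix Fin.succ Fin.castSucc).det := by
  let X := Matrix.mvPolynomialX (Fin (n + 2)) (Fin (n + 2)) ℤ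
  have hX := desnanot_jacobi_of_isLeftRegular X
    (IsLeftCancelMulZero.mul_left_cancel_of_ne_zero (Matrix.det_mvPolynomialX_ne_zero _ _))
  let f : MvPolynomial (Fin (n + 2) × Fin (n + 2)) ℤ →+* R :=
    MvPolynomial.eval₂Hom (Int.castRingHom R) fun p => A p.1 p.2
  have hf : X.map f = A := by
    ext i j
    simp [X, f]
  have := congrArg f hX
  simpa only [map_sub, map_mul, RingHom.map_det, RingHom.mapMatrix_apply, ← Matrix.submatrix_map,
    hf] using this

/-- The number of one-row tableaux of length `k` in the first `c` letters, of which the first `M`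
may be repeated and the others may not. -/
noncomputable def oneRowCount (M : ℕ) : ℕ → ℤ → ℤ
  | 0, k => if k = 0 then 1 else 0
  | c + 1, k => if c < M then ∑ j ∈ Finset.Icc 0 k, oneRowCount M c j
      else oneRowCount M c k + oneRowCount M c (k - 1)

theorem oneRowCount_of_neg (M c : ℕ) {k : ℤ} (hk : k < 0) : oneRowCount M c k = 0 := by
  induction c generalizing k with
  | zero => simp [oneRowCount, hk.ne]
  | succ c ih =>
    rw [oneRowCount, Finset.Icc_eq_empty (by omega), ih hk, ih (by omega)]
    simp

theorem oneRowCount_succ_of_lt {M c : ℕ} (hc : c < M) (k : ℤ) :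
    oneRowCount M (c + 1) k = oneRowCount M (c + 1) (k - 1) + oneRowCount M c k := by
  rcases lt_or_ge k 0 with hk | hk
  · simp [oneRowCount_of_neg _ _ hk, oneRowCount_of_neg _ _ (show k - 1 < 0 by omega)]
  · have : Finset.Icc 0 k = insert k (Finset.Icc 0 (k - 1)) := by
      ext; simp; omega
    simp only [oneRowCount, hc, if_true]
    rw [this, Finset.sum_insert (by simp), add_comm]

theorem oneRowCount_succ_of_le {M c : ℕ} (hc : M ≤ c) (k : ℤ) :
    oneRowCount M (c + 1) k = oneRowCount M c k + oneRowCount M c (k - 1) := by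
  simp [oneRowCount, hc.not_gt]

theorem sum_Icc_oneRowCount {M c : ℕ} (hc : c < M) (s : ℤ) {a b : ℤ} (hab : a ≤ b) :
    ∑ j ∈ Finset.Icc a b, oneRowCount M c (j + s) =
      oneRowCount M (c + 1) (b + s) - oneRowCount M (c + 1) (a - 1 + s) := by
  induction b, hab using Int.leInduction with
  | base =>
    rw [Finset.Icc_self, Finset.sum_singleton, oneRowCount_succ_of_lt hc (a + s),
      show a + s - 1 = a - 1 + s by ring]
    ring
  | succ b hb ih =>
    have : Finset.Icc a (b + 1) = insert (b + 1) (Finset.Icc a b) := by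
      ext; simp; omega
    rw [this, Finset.sum_insert (by simp), ih, oneRowCount_succ_of_lt hc (b + 1 + s),
      show b + 1 + s - 1 = b + s by ring]
    ring

/-- The Jacobi–Trudi matrix of the shape whose row lengths, from bottom to top, are `lam`. -/
noncomputable def jacobiTrudi (M c : ℕ) {n : ℕ} (lam : Fin n → ℤ) : Matrix (Fin n) (Fin n) ℤ :=
  .of fun i j => oneRowCount M c (lam i + (i - j))

/-- The ways `mu` to remove the cells holding the letter `c + 1` from the shape `lam`. -/
noncomputable def strips (M c : ℕ) {n : ℕ} (lam : Fin n → ℤ) : Finset (Fin n → ℤ) :=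
  open Classical in
  (Fintype.piFinset fun i => Finset.Icc 0 (lam i)).filter fun mu =>
    Monotone mu ∧ (c < M → ∀ i j, i < j → lam i ≤ mu j) ∧ (M ≤ c → ∀ i, lam i ≤ mu i + 1)

theorem mem_strips {M c n : ℕ} {lam mu : Fin n → ℤ} :
    mu ∈ strips M c lam ↔ (∀ i, 0 ≤ mu i ∧ mu i ≤ lam i) ∧ Monotone mu ∧
      (c < M → ∀ i j, i < j → lam i ≤ mu j) ∧ (M ≤ c → ∀ i, lam i ≤ mu i + 1) := by
  simp [strips]

theorem det_sum_rows {n : ℕ} (A : Fin n → Finset ℤ) (g : Fin n → ℤ → Fin n → ℤ) :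
    (Matrix.of fun i j => ∑ x ∈ A i, g i x j).det =
      ∑ mu ∈ Fintype.piFinset A, (Matrix.of fun i j => g i (mu i) j).det := by
  have := (Matrix.detRowAlternating (n := Fin n) (R := ℤ)).toMultilinearMap.map_sum_finset g A
  refine Eq.trans (congrArg Matrix.det (Matrix.ext fun i j => ?_)) this
  simp

theorem det_jacobiTrudi_succ_of_lt {M c n : ℕ} (hc : c < M) {lam : Fin n → ℤ}
    (hlam : Monotone lam) (hpos : ∀ i, 0 ≤ lam i) :
    (jacobiTrudi M (c + 1) lam).det = ∑ mu ∈ strips M c lam, (jacobiTrudi M c mu).det := by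
  cases n with
  | zero =>
    have : strips M c lam = {lam} := by
      ext mu
      simp [mem_strips, Subsingleton.elim mu lam, Subsingleton.monotone]
    simp [this]
  | succ n =>
    let lo : Fin (n + 1) → ℤ := Fin.cons 0 fun i => lam i.castSucc
    have hlo : ∀ i, lo i ≤ lam i := by
      intro i
      cases i using Fin.cases with
      | zero => exact hpos 0
      | succ i => exact hlam i.castSucc_le_succ
    have hstrips : strips M c lam = Fintype.piFinset fun i => Finset.Icc (lo i) (lam i) := by
      ext mu
      simp only [mem_strips, Fintype.mem_piFinset, Finset.mem_Icc]
      constructor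
      · rintro ⟨hb, -, hs, -⟩ i
        refine ⟨?_, (hb i).2⟩
        cases i using Fin.cases with
        | zero => exact (hb 0).1
        | succ i => exact hs hc _ _ i.castSucc_lt_succ
      · intro h
        have hmu : Monotone mu := Fin.monotone_iff_le_succ.2 fun i =>
          (h i.castSucc).2.trans (h i.succ).1
        refine ⟨fun i => ⟨(h 0).1.trans (hmu i.zero_le), (h i).2⟩, hmu, fun _ i j hij => ?_,
          fun h => by omega⟩
        cases j using Fin.cases with
        | zero => simp at hij
        | succ j => exact (hlam (Fin.le_castSucc_iff.2 hij)).trans (h j.succ).1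
    rw [hstrips]
    refine Eq.trans ?_ (det_sum_rows _ fun i x j => oneRowCount M c (x + (i - j)))
    refine Matrix.det_eq_of_forall_row_eq_smul_add_pred (fun _ => 1) (fun j => ?_) fun i j => ?_
    · simp only [jacobiTrudi, Matrix.of_apply]
      rw [sum_Icc_oneRowCount hc _ (hlo 0), oneRowCount_of_neg _ _ (k := lo 0 - 1 + _), sub_zero]
      simp [lo]
      omega
    · simp only [jacobiTrudi, Matrix.of_apply]
      rw [sum_Icc_oneRowCount hc _ (hlo i.succ)]
      simp only [lo, Fin.cons_succ, Fin.val_succ, Fin.val_castSucc]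
      push_cast
      rw [show lam i.castSucc - 1 + ((i : ℤ) + 1 - j) = lam i.castSucc + (i - j) by ring]
      ring

theorem det_jacobiTrudi_succ_of_le {M c n : ℕ} (hc : M ≤ c) {lam : Fin n → ℤ}
    (hlam : Monotone lam) (hpos : ∀ i, 0 ≤ lam i) :
    (jacobiTrudi M (c + 1) lam).det = ∑ mu ∈ strips M c lam, (jacobiTrudi M c mu).det := by
  have hrow : jacobiTrudi M (c + 1) lam = .of fun i j =>
      ∑ x ∈ Finset.Icc (lam i - 1) (lam i), oneRowCount M c (x + (i - j)) := by
    ext i j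
    have : Finset.Icc (lam i - 1) (lam i) = {lam i, lam i - 1} := by
      ext; simp; omega
    simp only [jacobiTrudi, Matrix.of_apply]
    rw [this, Finset.sum_pair (by omega), oneRowCount_succ_of_le hc,
      show lam i + ((i : ℤ) - j) - 1 = lam i - 1 + (i - j) by ring]
  rw [hrow, det_sum_rows _ fun i x j => oneRowCount M c (x + (i - j))]
  symm
  refine Finset.sum_subset (fun mu hmu => ?_) fun mu hmu hnot => ?_
  · rw [mem_strips] at hmu
    simp only [Fintype.mem_piFinset, Finset.mem_Icc]
    exact fun i => ⟨by linarith [hmu.2.2.2 hc i], (hmu.1 i).2⟩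
  · simp only [Fintype.mem_piFinset, Finset.mem_Icc] at hmu
    cases n with
    | zero =>
      exact absurd (mem_strips.2 ⟨finZeroElim, Subsingleton.monotone _, fun _ => finZeroElim,
        fun _ => finZeroElim⟩) hnot
    | succ n =>
      by_cases hmono : Monotone mu
      · have h0 : mu 0 < 0 := by
          by_contra! h0
          exact hnot (mem_strips.2 ⟨fun i => ⟨h0.trans (hmono i.zero_le), (hmu i).2⟩, hmono,
            fun h => by omega, fun _ i => by linarith [(hmu i).1]⟩)
        refine Matrix.det_eq_zero_of_row_eq_zero 0 fun j => oneRowCount_of_neg _ _ ?_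
        simp
        omega
      · rw [Fin.monotone_iff_le_succ] at hmono
        push Not at hmono
        obtain ⟨i, hi⟩ := hmono
        refine Matrix.det_zero_of_row_eq i.castSucc_lt_succ.ne (funext fun j => ?_)
        have := hlam i.castSucc_le_succ
        have h1 := hmu i.castSucc
        have h2 := hmu i.succ
        change oneRowCount M c _ = oneRowCount M c _
        congr 1
        simp only [Fin.val_succ, Fin.val_castSucc]
        push_cast
        omega

theorem det_jacobiTrudi_succ (M c : ℕ) {n : ℕ} {lam : Fin n → ℤ}
    (hlam : Monotone lam) (hpos : ∀ i, 0 ≤ lam i) :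
    (jacobiTrudi M (c + 1) lam).det = ∑ mu ∈ strips M c lam, (jacobiTrudi M c mu).det :=
  (lt_or_ge c M).elim (fun h => det_jacobiTrudi_succ_of_lt h hlam hpos)
    fun h => det_jacobiTrudi_succ_of_le h hlam hpos

theorem det_jacobiTrudi_zero (M : ℕ) {n : ℕ} {lam : Fin n → ℤ}
    (hlam : Monotone lam) (hpos : ∀ i, 0 ≤ lam i) :
    (jacobiTrudi M 0 lam).det = if lam = 0 then 1 else 0 := by
  split_ifs with h
  · have : jacobiTrudi M 0 lam = 1 := by
      ext i j
      simp [jacobiTrudi, oneRowCount, h, Matrix.one_apply, Fin.ext_iff, sub_eq_zero]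
    simp [this]
  · cases n with
    | zero => exact absurd (Subsingleton.elim _ _) h
    | succ n =>
      have hlast : 0 < lam (Fin.last n) := by
        by_contra! hle
        exact h (funext fun i => le_antisymm ((hlam i.le_last).trans hle) (hpos i))
      refine Matrix.det_eq_zero_of_row_eq_zero (Fin.last n) fun j => ?_
      simp only [jacobiTrudi, oneRowCount, Matrix.of_apply, Fin.val_last]
      rw [if_neg]
      omega

/-- The Young diagram whose row lengths, from bottom to top, are `lam`. -/
def diagram {n : ℕ} (lam : Fin n → ℤ) : Set (ℕ × ℕ) :=
  {p | ∃ k : Fin n, p.1 + k = n ∧ 1 ≤ p.2 ∧ (p.2 : ℤ) ≤ lam k}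

theorem mem_diagram_iff {n : ℕ} {lam : Fin n → ℤ} {a l : ℕ} {k : Fin n} (ha : a + k = n) :
    (a, l) ∈ diagram lam ↔ 1 ≤ l ∧ (l : ℤ) ≤ lam k := by
  refine ⟨?_, fun h => ⟨k, ha, h⟩⟩
  rintro ⟨k', hk', h⟩
  have : k' = k := Fin.ext (by simp only at hk'; omega)
  exact this ▸ h

theorem sub_mem_diagram_iff {n : ℕ} {lam : Fin n → ℤ} (k : Fin n) {l : ℕ} :
    (n - (k : ℕ), l) ∈ diagram lam ↔ 1 ≤ l ∧ (l : ℤ) ≤ lam k :=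
  mem_diagram_iff (Nat.sub_add_cancel k.is_lt.le)

theorem diagram_mono {n : ℕ} {mu lam : Fin n → ℤ} (h : ∀ i, mu i ≤ lam i) :
    diagram mu ⊆ diagram lam :=
  fun _ ⟨k, hk, h1, h2⟩ => ⟨k, hk, h1, h2.trans (h k)⟩

theorem mem_diagram_of_le {n : ℕ} {mu lam : Fin n → ℤ} (hmu : Monotone mu) {p q : ℕ × ℕ}
    (hp : p ∈ diagram lam) (hq : q ∈ diagram mu) (h1 : p.1 ≤ q.1) (h2 : p.2 ≤ q.2) :
    p ∈ diagram mu := by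
  obtain ⟨k, hk, hl, -⟩ := hp
  obtain ⟨k', hk', hl', hle⟩ := hq
  have : k' ≤ k := Fin.le_def.2 (by omega)
  exact ⟨k, hk, hl, by linarith [hmu this, (Int.ofNat_le.2 h2 : (p.2 : ℤ) ≤ q.2)]⟩

theorem diagram_injOn {n : ℕ} :
    Set.InjOn (diagram (n := n)) {lam | ∀ i, 0 ≤ lam i} := by
  have key : ∀ lam mu : Fin n → ℤ, (∀ i, 0 ≤ lam i) → (∀ i, 0 ≤ mu i) →
      diagram lam = diagram mu → ∀ k, lam k ≤ mu k := by
    intro lam mu hl hm h k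
    by_contra! hlt
    have hmem : (n - (k : ℕ), (lam k).toNat) ∈ diagram lam :=
      (sub_mem_diagram_iff _).2 ⟨by have := hm k; omega, by have := hl k; omega⟩
    rw [h, sub_mem_diagram_iff] at hmem
    have := hl k
    omega
  exact fun lam hl mu hm h => funext fun k =>
    le_antisymm (key lam mu hl hm h k) (key mu lam hm hl h.symm k)

/-- Tableaux of shape `lam` in the letters `1, …, c`, where the letters up to `M` are strict along
columns and the others are strict along rows. -/
def tableaux (M c : ℕ) {n : ℕ} (lam : Fin n → ℤ) : Set (ℕ × ℕ → ℕ) :=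
  {T | (∀ p, p ∉ diagram lam → T p = 0) ∧
    (∀ p ∈ diagram lam, 1 ≤ T p ∧ T p ≤ c) ∧
    (∀ p ∈ diagram lam, ∀ p' ∈ diagram lam, p.1 ≤ p'.1 → p.2 ≤ p'.2 → T p ≤ T p') ∧
    (∀ p ∈ diagram lam, (p.1 + 1, p.2) ∈ diagram lam → T p ≤ M → T p < T (p.1 + 1, p.2)) ∧
    (∀ p ∈ diagram lam, (p.1, p.2 + 1) ∈ diagram lam → M < T p → T p < T (p.1, p.2 + 1))}

/-- Fill the cells of `lam` outside `mu` with the letter `c + 1`. -/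
noncomputable def extend (c : ℕ) {n : ℕ} (lam mu : Fin n → ℤ) (T : ℕ × ℕ → ℕ) : ℕ × ℕ → ℕ :=
  open Classical in
  fun p => if p ∈ diagram mu then T p else if p ∈ diagram lam then c + 1 else 0

theorem extend_mem_tableaux {M c n : ℕ} {lam mu : Fin n → ℤ} (hmu : mu ∈ strips M c lam)
    {T : ℕ × ℕ → ℕ} (hT : T ∈ tableaux M c mu) : extend c lam mu T ∈ tableaux M (c + 1) lam := by
  obtain ⟨hb, hmono, hh, hv⟩ := mem_strips.1 hmu
  obtain ⟨-, hrange, hle, hcol, hrow⟩ := hT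
  have hsub := diagram_mono fun i => (hb i).2
  refine ⟨fun p hp => ?_, fun p hp => ?_, fun p hp q hq h1 h2 => ?_, fun p hp hq hM => ?_,
    fun p hp hq hM => ?_⟩
  · have hpm : p ∉ diagram mu := fun h => hp (hsub h)
    simp [extend, hp, hpm]
  · by_cases hpm : p ∈ diagram mu
    · have := hrange p hpm
      simp only [extend, hpm, if_true]
      omega
    · simp [extend, hpm, hp]
  · by_cases hqm : q ∈ diagram mu
    · have hpm := mem_diagram_of_le hmono hp hqm h1 h2
      simpa [extend, hpm, hqm] using hle p hpm q hqm h1 h2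
    · by_cases hpm : p ∈ diagram mu
      · have := hrange p hpm
        simp only [extend, hpm, hqm, hq, if_true, if_false]
        omega
      · simp [extend, hpm, hqm, hp, hq]
  · by_cases hpm : p ∈ diagram mu
    · by_cases hqm : (p.1 + 1, p.2) ∈ diagram mu
      · simp only [extend, hpm, hqm, if_true] at hM ⊢
        exact hcol p hpm hqm hM
      · have := hrange p hpm
        simp only [extend, hpm, hqm, hq, if_true, if_false]
        omega
    · exfalso
      simp only [extend, hpm, hp, if_true, if_false] at hM
      obtain ⟨k, hk, hl, -⟩ := hp
      obtain ⟨k', hk', -, hl'⟩ := hq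
      have := hh (by omega) k' k (Fin.lt_def.2 (by simp only at hk'; omega))
      exact hpm ⟨k, hk, hl, hl'.trans this⟩
  · by_cases hpm : p ∈ diagram mu
    · by_cases hqm : (p.1, p.2 + 1) ∈ diagram mu
      · simp only [extend, hpm, hqm, if_true] at hM ⊢
        exact hrow p hpm hqm hM
      · have := hrange p hpm
        simp only [extend, hpm, hqm, hq, if_true, if_false]
        omega
    · exfalso
      simp only [extend, hpm, hp, if_true, if_false] at hM
      obtain ⟨k, hk, hl, -⟩ := hp
      have hl' := ((mem_diagram_iff hk).1 hq).2
      have := hv (by omega) k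
      push_cast at hl'
      exact hpm ⟨k, hk, hl, by linarith⟩

theorem exists_strip_of_mem_tableaux {M c n : ℕ} {lam : Fin n → ℤ} (hlam : Monotone lam)
    (hpos : ∀ i, 0 ≤ lam i) {T : ℕ × ℕ → ℕ} (hT : T ∈ tableaux M (c + 1) lam) :
    ∃ mu ∈ strips M c lam, ∃ T' ∈ tableaux M c mu, extend c lam mu T' = T := by
  classical
  obtain ⟨hzero, hrange, hle, hcol, hrow⟩ := hT
  let mu : Fin n → ℤ := fun k =>
    (Nat.findGreatest (fun l => T (n - k, l) ≤ c) (lam k).toNat : ℕ)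
  have hmu_le : ∀ k, mu k ≤ lam k := fun k => by
    have := Nat.findGreatest_le (P := fun l => T (n - k, l) ≤ c) (lam k).toNat
    have := hpos k
    simp only [mu]
    omega
  have hmem : ∀ p, p ∈ diagram mu ↔ p ∈ diagram lam ∧ T p ≤ c := by
    rintro ⟨a, l⟩
    constructor
    · rintro ⟨k, hk, hl, hlk⟩
      simp only at hk hl hlk
      have hlam_mem : (a, l) ∈ diagram lam := ⟨k, hk, hl, hlk.trans (hmu_le k)⟩
      refine ⟨hlam_mem, ?_⟩
      have ha : n - (k : ℕ) = a := by omega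
      have hT0 : T (n - k, 0) ≤ c := by
        rw [hzero _ (by rw [sub_mem_diagram_iff]; simp)]
        exact c.zero_le
      have hspec := Nat.findGreatest_spec (P := fun l => T (n - k, l) ≤ c)
        (Nat.zero_le (lam k).toNat) hT0
      simp only [mu, Nat.cast_le] at hlk
      have hbd := hmu_le k
      refine (hle (a, l) hlam_mem
        (a, Nat.findGreatest (fun l => T (n - k, l) ≤ c) (lam k).toNat) ?_ le_rfl hlk).trans ?_
      · exact ⟨k, hk, hl.trans hlk, hbd⟩
      · rw [ha] at hspec ⊢
        exact hspec
    · rintro ⟨⟨k, hk, hl, hlk⟩, hTc⟩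
      simp only at hk hl hlk
      have ha : n - (k : ℕ) = a := by omega
      refine ⟨k, hk, hl, ?_⟩
      simp only [mu, Nat.cast_le]
      exact Nat.le_findGreatest (by omega) (by rw [ha]; exact hTc)
  have hmu_mem : ∀ (k : Fin n) (l : ℕ), 1 ≤ l → (l : ℤ) ≤ lam k → mu k < l → c < T (n - k, l) := by
    intro k l hl hlk hlt
    by_contra! hc
    have h1 : (n - (k : ℕ), l) ∈ diagram lam := (sub_mem_diagram_iff _).2 ⟨hl, hlk⟩
    have := (sub_mem_diagram_iff k).1 ((hmem _).2 ⟨h1, hc⟩)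
    omega
  have hmu_nonneg : ∀ k, 0 ≤ mu k := fun k => Int.natCast_nonneg _
  refine ⟨mu, mem_strips.2 ⟨fun k => ⟨hmu_nonneg k, hmu_le k⟩, ?_, ?_, ?_⟩,
    fun p => if p ∈ diagram mu then T p else 0, ⟨?_, ?_, ?_, ?_, ?_⟩, ?_⟩
  · intro i j hij
    by_contra! hlt
    have hi := hmu_nonneg j
    have h1 : (n - (i : ℕ), (mu i).toNat) ∈ diagram mu :=
      (sub_mem_diagram_iff _).2 ⟨by omega, by omega⟩
    have h2 : (n - (j : ℕ), (mu i).toNat) ∈ diagram lam :=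
      (sub_mem_diagram_iff _).2 ⟨by omega, by have := hlam hij; have := hmu_le i; omega⟩
    have h3 := (hmem _).1 h1
    have h4 := hle _ h2 _ h3.1 (by have := Fin.le_def.1 hij; simp only; omega) le_rfl
    have := (sub_mem_diagram_iff j).1 ((hmem _).2 ⟨h2, h4.trans h3.2⟩)
    omega
  · intro hcM i j hij
    by_contra! hlt
    have hi := hmu_nonneg j
    have hij' := Fin.lt_def.1 hij
    have hlij := hlam hij.le
    have h1 := hmu_mem j (lam i).toNat (by omega) (by omega) (by omega)
    have hj : (n - (j : ℕ), (lam i).toNat) ∈ diagram lam :=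
      (sub_mem_diagram_iff _).2 ⟨by omega, by omega⟩
    have hi' : (n - (i : ℕ), (lam i).toNat) ∈ diagram lam :=
      (sub_mem_diagram_iff _).2 ⟨by omega, by omega⟩
    have hj1 : (n - (j : ℕ) + 1, (lam i).toNat) ∈ diagram lam :=
      mem_diagram_of_le (lam := fun _ => lam i) hlam
        ⟨⟨(j : ℕ) - 1, by omega⟩, by simp only; omega, by simp only; omega, by simp only; omega⟩
        hi' (by simp only; omega) le_rfl
    have h2 := hcol _ hj hj1 (by have := (hrange _ hj).2; omega)
    have := (hrange _ hj1).2
    simp only at h2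
    omega
  · intro hMc i
    by_contra! hlt
    have hi := hmu_nonneg i
    have h1 := hmu_mem i ((mu i).toNat + 1) (by omega) (by omega) (by omega)
    have hj : (n - (i : ℕ), (mu i).toNat + 1) ∈ diagram lam :=
      (sub_mem_diagram_iff _).2 ⟨by omega, by omega⟩
    have hj1 : (n - (i : ℕ), (mu i).toNat + 1 + 1) ∈ diagram lam :=
      (sub_mem_diagram_iff _).2 ⟨by omega, by omega⟩
    have h2 := hrow _ hj hj1 (by omega)
    have := (hrange _ hj1).2
    simp only at h2
    omega
  · intro p hp
    simp [hp]
  · intro p hp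
    simp only [hp, if_true]
    exact ⟨(hrange p ((hmem p).1 hp).1).1, ((hmem p).1 hp).2⟩
  · intro p hp q hq h1 h2
    simp only [hp, hq, if_true]
    exact hle p ((hmem p).1 hp).1 q ((hmem q).1 hq).1 h1 h2
  · intro p hp hq hM
    simp only [hp, hq, if_true] at hM ⊢
    exact hcol p ((hmem p).1 hp).1 ((hmem _).1 hq).1 hM
  · intro p hp hq hM
    simp only [hp, hq, if_true] at hM ⊢
    exact hrow p ((hmem p).1 hp).1 ((hmem _).1 hq).1 hM
  · funext p
    by_cases hp : p ∈ diagram mu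
    · simp [extend, hp]
    · by_cases hpl : p ∈ diagram lam
      · have h1 := (hrange p hpl).2
        have h2 : ¬ T p ≤ c := fun h => hp ((hmem p).2 ⟨hpl, h⟩)
        simp only [extend, hp, hpl, if_true, if_false]
        omega
      · simp [extend, hp, hpl, hzero p hpl]

theorem tableaux_succ (M c : ℕ) {n : ℕ} {lam : Fin n → ℤ} (hlam : Monotone lam)
    (hpos : ∀ i, 0 ≤ lam i) :
    tableaux M (c + 1) lam =
      ⋃ mu ∈ (strips M c lam : Set (Fin n → ℤ)), extend c lam mu '' tableaux M c mu := by
  ext T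
  simp only [Set.mem_iUnion, Set.mem_image, Finset.mem_coe, exists_prop]
  constructor
  · exact exists_strip_of_mem_tableaux hlam hpos
  · rintro ⟨mu, hmu, T', hT', rfl⟩
    exact extend_mem_tableaux hmu hT'

theorem extend_injOn (M c : ℕ) {n : ℕ} (lam mu : Fin n → ℤ) :
    Set.InjOn (extend c lam mu) (tableaux M c mu) := by
  intro T hT T' hT' h
  funext p
  by_cases hp : p ∈ diagram mu
  · simpa [extend, hp] using congrFun h p
  · rw [hT.1 p hp, hT'.1 p hp]

theorem diagram_eq_of_extend {M c n : ℕ} {lam mu : Fin n → ℤ} {T : ℕ × ℕ → ℕ}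
    (hT : T ∈ tableaux M c mu) :
    diagram mu = {p | 1 ≤ extend c lam mu T p ∧ extend c lam mu T p ≤ c} := by
  ext p
  by_cases hp : p ∈ diagram mu
  · simpa [extend, hp] using hT.2.1 p hp
  · by_cases hpl : p ∈ diagram lam <;> simp [extend, hp, hpl]

theorem pairwiseDisjoint_extend_image (M c : ℕ) {n : ℕ} (lam : Fin n → ℤ) :
    (strips M c lam : Set (Fin n → ℤ)).PairwiseDisjoint
      fun mu => extend c lam mu '' tableaux M c mu := by
  intro mu hmu nu hnu hne
  refine Set.disjoint_left.2 ?_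
  rintro _ ⟨T, hT, rfl⟩ ⟨T', hT', h⟩
  refine hne (diagram_injOn (fun i => ((mem_strips.1 hmu).1 i).1)
    (fun i => ((mem_strips.1 hnu).1 i).1) ?_)
  rw [diagram_eq_of_extend (lam := lam) hT, diagram_eq_of_extend (lam := lam) hT', h]

theorem tableaux_zero (M : ℕ) {n : ℕ} {lam : Fin n → ℤ} (hpos : ∀ i, 0 ≤ lam i) :
    tableaux M 0 lam = if lam = 0 then {0} else ∅ := by
  have hempty : ∀ p, p ∉ diagram (0 : Fin n → ℤ) := by
    rintro p ⟨k, -, h1, h2⟩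
    simp only [Pi.zero_apply] at h2
    omega
  split_ifs with h
  · subst h
    ext T
    simp [tableaux, hempty, funext_iff]
  · refine Set.eq_empty_of_forall_notMem fun T hT => h ?_
    refine diagram_injOn hpos (fun _ => le_rfl) (Set.ext fun p => ?_)
    refine iff_of_false (fun hp => ?_) (hempty p)
    have := hT.2.1 p hp
    omega

/-- The Jacobi–Trudi formula for the number of tableaux of a given shape. -/
theorem finite_and_ncard_tableaux (M c : ℕ) {n : ℕ} {lam : Fin n → ℤ} (hlam : Monotone lam)
    (hpos : ∀ i, 0 ≤ lam i) :
    (tableaux M c lam).Finite ∧ ((tableaux M c lam).ncard : ℤ) = (jacobiTrudi M c lam).det := by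
  induction c generalizing lam with
  | zero =>
    rw [tableaux_zero M hpos, det_jacobiTrudi_zero M hlam hpos]
    split_ifs <;> simp
  | succ c ih =>
    have ih' : ∀ mu ∈ strips M c lam, (tableaux M c mu).Finite ∧
        ((tableaux M c mu).ncard : ℤ) = (jacobiTrudi M c mu).det := fun mu hmu =>
      ih (mem_strips.1 hmu).2.1 fun i => ((mem_strips.1 hmu).1 i).1
    have hfin : ∀ mu ∈ (strips M c lam : Set (Fin n → ℤ)),
        (extend c lam mu '' tableaux M c mu).Finite := fun mu hmu => (ih' mu hmu).1.image _
    rw [tableaux_succ M c hlam hpos]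
    refine ⟨(strips M c lam).finite_toSet.biUnion hfin, ?_⟩
    rw [Set.Finite.ncard_biUnion (strips M c lam).finite_toSet hfin
        (pairwiseDisjoint_extend_image M c lam), finsum_mem_coe_finset,
      det_jacobiTrudi_succ M c hlam hpos, Nat.cast_sum]
    refine Finset.sum_congr rfl fun mu hmu => ?_
    rw [(extend_injOn M c lam mu).ncard_image, (ih' mu hmu).2]

theorem Bpos_wt {M N i m : ℕ} (hi : i ≤ M) :
    Bpos M N (wt i m) = tableaux M (M + N) fun _ : Fin i => (m : ℤ) := by
  have : Yp M N (wt i m) = diagram fun _ : Fin i => (m : ℤ) := by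
    ext ⟨a, l⟩
    simp only [Yp, diagram, wt, Set.mem_ofPred_eq, Nat.cast_le]
    constructor
    · rintro ⟨h1, h2, ⟨h3, h4⟩ | ⟨h3, h4, h5⟩⟩
      · split_ifs at h4 with h
        · exact ⟨⟨i - a, by omega⟩, by simp only; omega, h2, h4⟩
        · omega
      · rw [if_neg (by omega)] at h5
        omega
    · rintro ⟨k, hk, h1, h2⟩
      refine ⟨by omega, h1, Or.inl ⟨by omega, ?_⟩⟩
      rwa [if_pos (by omega)]
  simp only [Bpos, tableaux, this]

/-- The Jacobi–Trudi determinants of rectangular shapes satisfy the T-system. -/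
theorem det_jacobiTrudi_rectangle (M c n : ℕ) (m : ℤ) :
    (jacobiTrudi M c fun _ : Fin (n + 1) => m).det ^ 2 =
      (jacobiTrudi M c fun _ : Fin (n + 1) => m + 1).det *
          (jacobiTrudi M c fun _ : Fin (n + 1) => m - 1).det +
        (jacobiTrudi M c fun _ : Fin n => m).det *
          (jacobiTrudi M c fun _ : Fin (n + 2) => m).det := by
  have h := desnanot_jacobi (jacobiTrudi M c fun _ : Fin (n + 2) => m)
  have h1 : (jacobiTrudi M c fun _ : Fin (n + 2) => m).submatrix
      (fun i : Fin n => i.castSucc.succ) (fun i => i.castSucc.succ) =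
      jacobiTrudi M c fun _ : Fin n => m := by
    ext i j; simp [jacobiTrudi]
  have h2 : (jacobiTrudi M c fun _ : Fin (n + 2) => m).submatrix Fin.castSucc Fin.castSucc =
      jacobiTrudi M c fun _ : Fin (n + 1) => m := by
    ext i j; simp [jacobiTrudi]
  have h3 : (jacobiTrudi M c fun _ : Fin (n + 2) => m).submatrix Fin.succ Fin.succ =
      jacobiTrudi M c fun _ : Fin (n + 1) => m := by
    ext i j; simp [jacobiTrudi]
  have h4 : (jacobiTrudi M c fun _ : Fin (n + 2) => m).submatrix Fin.castSucc Fin.succ =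
      jacobiTrudi M c fun _ : Fin (n + 1) => m - 1 := by
    ext i j; simp [jacobiTrudi]; ring_nf
  have h5 : (jacobiTrudi M c fun _ : Fin (n + 2) => m).submatrix Fin.succ Fin.castSucc =
      jacobiTrudi M c fun _ : Fin (n + 1) => m + 1 := by
    ext i j; simp [jacobiTrudi]; ring_nf
  rw [h1, h2, h3, h4, h5] at h
  linear_combination -h

/-- the T-system dimension identity
`(d_m^{(i)})² = d_{m+1}^{(i)} d_{m-1}^{(i)} + d_m^{(i-1)} d_m^{(i+1)}` in its
combinatorial form via tableau counts. -/
theorem statement3 (M N : ℕ) (hM : 1 ≤ M) (hN : 1 ≤ N) (i m : ℕ)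
    (hi : 1 ≤ i) (hiM : i < M) (hm : 1 ≤ m) :
    (Bpos M N (wt i m)).Finite ∧ (Bpos M N (wt i (m + 1))).Finite ∧
    (Bpos M N (wt i (m - 1))).Finite ∧ (Bpos M N (wt (i - 1) m)).Finite ∧
    (Bpos M N (wt (i + 1) m)).Finite ∧
    (Bpos M N (wt i m)).ncard ^ 2 =
      (Bpos M N (wt i (m + 1))).ncard * (Bpos M N (wt i (m - 1))).ncard +
        (Bpos M N (wt (i - 1) m)).ncard * (Bpos M N (wt (i + 1) m)).ncard := by
  have hrect : ∀ j k : ℕ, j ≤ M → (Bpos M N (wt j k)).Finite ∧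
      ((Bpos M N (wt j k)).ncard : ℤ) = (jacobiTrudi M (M + N) fun _ : Fin j => (k : ℤ)).det := by
    intro j k hj
    rw [Bpos_wt hj]
    exact finite_and_ncard_tableaux M (M + N) monotone_const fun _ => Int.natCast_nonneg k
  refine ⟨(hrect _ _ hiM.le).1, (hrect _ _ hiM.le).1, (hrect _ _ hiM.le).1,
    (hrect _ _ (by omega)).1, (hrect _ _ hiM).1, ?_⟩
  zify
  rw [(hrect _ _ hiM.le).2, (hrect _ _ hiM.le).2, (hrect _ _ hiM.le).2,
    (hrect _ _ (by omega)).2, (hrect _ _ hiM).2]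
  obtain ⟨n, rfl⟩ := Nat.exists_eq_add_of_le' hi
  have h := det_jacobiTrudi_rectangle M (M + N) n m
  simpa [Nat.cast_sub hm] using h

end QAS
end

section
/- For all i ∈ I₀ and a ∈ ℂˣ one has the equivalence of ℓ-weights A_{i,a} ≡ (Ψ_{i,aq_i⁻²} · Ψ_{i,aq̂_i²}⁻¹) · ∏_{j∈I₀, j∼i} Ψ_{j,aq_{ij}⁻¹} · Ψ_{j,aq_{ij}}⁻¹. -/
open scoped Classical

noncomputable section

namespace QAS

/-- ℓ-weights: an `I`-tuple (indexed by `ℕ`, only indices `1,…,M+N` are relevant) of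
rational functions together with a parity in `ℤ/2`.  The group law is componentwise
multiplication of rational functions and addition of parities. -/
abbrev LW : Type := (ℕ → RatFunc ℂ) × Multiplicative (ZMod 2)

/-- the variable `z` -/
def Z : RatFunc ℂ := RatFunc.X

/-- constant rational functions -/
def Cc (c : ℂ) : RatFunc ℂ := RatFunc.C c

/-- parity `|ε_j|` (indices are 1-based) -/
def par (M : ℕ) (j : ℕ) : ZMod 2 := if j ≤ M then 0 else 1

/-- `q_j` -/
def qq (M : ℕ) (q : ℂ) (j : ℕ) : ℂ := if j ≤ M then q else q⁻¹

/-- `(ε_j, ε_j) = ±1` -/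
def sgn (M : ℕ) (j : ℕ) : ℤ := if j ≤ M then 1 else -1

/-- `q̂_i` -/
def qhat (M : ℕ) (q : ℂ) (i : ℕ) : ℂ := if i = M then q⁻¹ else qq M q i

/-- `τ_i` -/
def tau (M N : ℕ) (q : ℂ) (i : ℕ) : ℂ :=
  if i ≤ M then q ^ ((M : ℤ) - N + 1 - i) else q ^ ((i : ℤ) - M + 1 - N)

/-- `θ_j` -/
def theta (M N : ℕ) (q : ℂ) (j : ℕ) : ℂ :=
  if j ≤ M then q ^ (2 * ((M : ℤ) - N + 1 - j)) else q ^ (2 * ((j : ℤ) - M - N))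

/-- `(ε_k, ε_l)` -/
def epsPair (M : ℕ) (k l : ℕ) : ℤ := if k = l then sgn M k else 0

/-- `(α_i, α_j)` where `α_i = ε_i - ε_{i+1}` -/
def alphaPair (M : ℕ) (i j : ℕ) : ℤ :=
  epsPair M i j - epsPair M i (j + 1) - epsPair M (i + 1) j + epsPair M (i + 1) (j + 1)

/-- the set of `j ∈ I₀` with `j ∼ i`, i.e. `|i - j| = 1` -/
def nbr (M N : ℕ) (i : ℕ) : Finset ℕ :=
  (Finset.Icc 1 (M + N - 1)).filter fun j => j + 1 = i ∨ j = i + 1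

/-- the ℓ-weight `⬜j_a` -/
def box (M N : ℕ) (q : ℂ) (j : ℕ) (a : ℂ) : LW :=
  (fun k => if k = j then
      Cc (qq M q j) * (1 - Cc (a * (theta M N q j)⁻¹ * (qq M q j)⁻¹) * Z) /
        (1 - Cc (a * (theta M N q j)⁻¹ * qq M q j) * Z)
    else 1,
   Multiplicative.ofAdd (par M j))

/-- the generalized simple root `A_{i,a}` -/
def Amat (M N : ℕ) (q : ℂ) (i : ℕ) (a : ℂ) : LW :=
  (fun k =>
    if k = i then
      Cc (qq M q i) *
        (1 - Cc (a * tau M N q i * q⁻¹ * (theta M N q i)⁻¹ * (qq M q i)⁻¹) * Z) /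
        (1 - Cc (a * tau M N q i * q⁻¹ * (theta M N q i)⁻¹ * qq M q i) * Z)
    else if k = i + 1 then
      Cc (qq M q (i + 1))⁻¹ *
        (1 - Cc (a * tau M N q i * q⁻¹ * (theta M N q i)⁻¹ * qq M q i * qq M q (i + 1) ^ 2) * Z) /
        (1 - Cc (a * tau M N q i * q⁻¹ * (theta M N q i)⁻¹ * qq M q i) * Z)
    else 1,
   Multiplicative.ofAdd (par M i + par M (i + 1)))

/-- the prefundamental ℓ-weight `Ψ_{i,a}` -/
def Psi (M N : ℕ) (q : ℂ) (i : ℕ) (a : ℂ) : LW :=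
  (fun k =>
    if i ≤ M then (if 1 ≤ k ∧ k ≤ i then 1 - Cc (a * (tau M N q i)⁻¹) * Z else 1)
    else (if i < k ∧ k ≤ M + N then (1 - Cc (a * (tau M N q i)⁻¹) * Z)⁻¹ else 1),
   1)

/-- the ℓ-weight `[a]_i` -/
def bra (M N : ℕ) (i : ℕ) (a : ℂ) : LW :=
  (fun k =>
    if i ≤ M then (if 1 ≤ k ∧ k ≤ i then Cc a else 1)
    else (if i < k ∧ k ≤ M + N then Cc a⁻¹ else 1),
   1)

/-- the ℓ-weight `𝔴^{(i)}_{c,a} = [c]_i Ψ_{i,ac⁻²} Ψ_{i,a}⁻¹` -/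
def wAsym (M N : ℕ) (q : ℂ) (i : ℕ) (c a : ℂ) : LW :=
  bra M N i c * Psi M N q i (a * (c ^ 2)⁻¹) * (Psi M N q i a)⁻¹

/-- the ℓ-weight `𝔫^{(i)}_{c,a}` -/
def nAsym (M N : ℕ) (q : ℂ) (i : ℕ) (c a : ℂ) : LW :=
  wAsym M N q i (qhat M q i) (a * qhat M q i ^ 2) *
    ∏ j ∈ nbr M N i, wAsym M N q j ((c ^ alphaPair M i j)⁻¹) (a * q ^ alphaPair M i j)

/-- a scalar rational function viewed as an ℓ-weight (all relevant components equal to it,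
parity `0̄`) -/
def scalarLW (M N : ℕ) (h : RatFunc ℂ) : LW :=
  (fun k => if 1 ≤ k ∧ k ≤ M + N then h else 1, 1)

/-- equivalence of ℓ-weights: `f ≡ g` iff `f g⁻¹ = ((h p_1, …, h p_κ); s)` with `h`
regular and nonvanishing at `z = 0` and `p_k ∈ ℂˣ` -/
def lequiv (M N : ℕ) (f g : LW) : Prop :=
  ∃ h : RatFunc ℂ, Polynomial.eval 0 h.denom ≠ 0 ∧ Polynomial.eval 0 h.num ≠ 0 ∧
    ∃ p : ℕ → ℂ, ∀ k, 1 ≤ k → k ≤ M + N → p k ≠ 0 ∧ f.1 k * (g.1 k)⁻¹ = h * Cc (p k)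

/-- substitution `z ↦ cz` in a rational function -/
def scaleVar (c : ℂ) (f : RatFunc ℂ) : RatFunc ℂ :=
  Polynomial.eval₂ (RatFunc.C : ℂ →+* RatFunc ℂ) (Cc c * Z) f.num /
    Polynomial.eval₂ (RatFunc.C : ℂ →+* RatFunc ℂ) (Cc c * Z) f.denom

/-- `C_i(f)(z) = ∏_{j=i}^{κ} f_j(zθ_j)^{(ε_j,ε_j)}` -/
def CFun (M N : ℕ) (q : ℂ) (i : ℕ) (f : LW) : RatFunc ℂ :=
  ∏ j ∈ Finset.Icc i (M + N), scaleVar (theta M N q j) (f.1 j) ^ sgn M j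

/-- `t_1 = θ_1` and `t_i = τ_{i-1}² q⁻²` for `i > 1` -/
def tSmall (M N : ℕ) (q : ℂ) (i : ℕ) : ℂ :=
  if i = 1 then theta M N q 1 else tau M N q (i - 1) ^ 2 * (q ^ 2)⁻¹

/-- the ℓ-weights `⬜j*_a`, defined by `⬜1*_a = (⬜1_{aθ_1})⁻¹` and
`⬜(i+1)*_a = ⬜i*_a · A_{i, aτ_i q⁻¹}` -/
def boxStar (M N : ℕ) (q : ℂ) : ℕ → ℂ → LW
  | 0, _ => 1
  | 1, a => (box M N q 1 (a * theta M N q 1))⁻¹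
  | i + 2, a => boxStar M N q (i + 1) a * Amat M N q (i + 1) (a * tau M N q (i + 1) * q⁻¹)

/-- auxiliary downwards recursion for `⬜j′_a`; the argument is `κ - j` -/
def boxPrimeAux (M N : ℕ) (q : ℂ) (a : ℂ) : ℕ → LW
  | 0 => (box M N q (M + N) a)⁻¹
  | d + 1 => boxPrimeAux M N q a d *
      (Amat M N q (M + N - (d + 1)) (a * tau M N q (M + N - (d + 1)) * q⁻¹))⁻¹

/-- the ℓ-weights `⬜j′_a`, defined by `⬜κ′_a = (⬜κ_a)⁻¹` and
`⬜(i+1)′_a = ⬜i′_a · A_{i, aτ_i q⁻¹}` -/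
def boxPrime (M N : ℕ) (q : ℂ) (j : ℕ) (a : ℂ) : LW := boxPrimeAux M N q a (M + N - j)

/-- `q^λ` as an ℓ-weight, for `λ ∈ ℤ^I` -/
def qpow (M N : ℕ) (q : ℂ) (lam : ℕ → ℤ) : LW :=
  (fun k => if 1 ≤ k ∧ k ≤ M + N then Cc (q ^ (lam k * sgn M k)) else 1,
   Multiplicative.ofAdd
     (((∑ k ∈ Finset.Icc 1 (M + N), if k ≤ M then (0 : ℤ) else lam k) : ZMod 2)))

/-- the fundamental weight `ϖ_i` for `i ≤ M` -/
def varpi (i : ℕ) : ℕ → ℤ := fun k => if 1 ≤ k ∧ k ≤ i then 1 else 0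

/-- `Y_{i,a}` for `i ≤ M` -/
def YLW (M N : ℕ) (q : ℂ) (i : ℕ) (a : ℂ) : LW :=
  qpow M N q (varpi i) * Psi M N q i (a * (qq M q i)⁻¹) * (Psi M N q i (a * qq M q i))⁻¹

/-- `ϖ^{(i)}_{m,a}` for `i ≤ M` -/
def varpiLW (M N : ℕ) (q : ℂ) (i m : ℕ) (a : ℂ) : LW :=
  qpow M N q (fun k => (m : ℤ) * varpi i k) *
    Psi M N q i (a * qq M q i ^ (1 - 2 * (m : ℤ))) * (Psi M N q i (a * qq M q i))⁻¹

/-- the submonoid `ℒ𝒬⁻` generated by the `A_{j,b}⁻¹` -/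
def LQneg (M N : ℕ) (q : ℂ) : Submonoid LW :=
  Submonoid.closure
    {w | ∃ j : ℕ, ∃ b : ℂ, 1 ≤ j ∧ j ≤ M + N - 1 ∧ b ≠ 0 ∧ w = (Amat M N q j b)⁻¹}

/-- `λ ∈ 𝒫` (1-based coordinates; `λ_j = 0` outside `1,…,M+N`) -/
def inP (M N : ℕ) (lam : ℕ → ℕ) : Prop :=
  lam 0 = 0 ∧ (∀ j, M + N < j → lam j = 0) ∧
  (∀ k l, 1 ≤ k → k ≤ l → l ≤ M → lam l ≤ lam k) ∧
  (∀ k l, M + 1 ≤ k → k ≤ l → l ≤ M + N → lam l ≤ lam k) ∧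
  (∀ j, 1 ≤ j → j ≤ N → 0 < lam (M + j) → j ≤ lam M)

/-- `Y₋^λ = -Y₊^λ ⊂ ℤ_{<0}²` -/
def YnZ (M N : ℕ) (lam : ℕ → ℕ) : Set (ℤ × ℤ) :=
  {p | ∃ k l : ℕ, (k, l) ∈ Yp M N lam ∧ p = (-(k : ℤ), -(l : ℤ))}

/-- tableau conditions on a domain `Y ⊂ ℤ²`, with entries in `{1,…,kap}` and the
strictness threshold `MM` (tableaux are encoded as functions `ℤ × ℤ → ℕ`
vanishing off `Y`) -/
def isTab (MM kap : ℕ) (Y : Set (ℤ × ℤ)) (T : ℤ × ℤ → ℕ) : Prop :=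
  (∀ p, p ∉ Y → T p = 0) ∧
  (∀ p ∈ Y, 1 ≤ T p ∧ T p ≤ kap) ∧
  (∀ p ∈ Y, ∀ p' ∈ Y, p.1 ≤ p'.1 → p.2 ≤ p'.2 → T p ≤ T p') ∧
  (∀ p ∈ Y, (p.1 + 1, p.2) ∈ Y → T p ≤ MM → T p < T (p.1 + 1, p.2)) ∧
  (∀ p ∈ Y, (p.1, p.2 + 1) ∈ Y → MM < T p → T p < T (p.1, p.2 + 1))

/-- the set of tableaux `ℬ₋(λ)` -/
def Bneg (M N : ℕ) (lam : ℕ → ℕ) : Set (ℤ × ℤ → ℕ) :=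
  {T | isTab M (M + N) (YnZ M N lam) T}

/-- `m_T = ∏_{k=1}^{i} ∏_{l=1}^{m} ⬜T(-k,-l)_{aτ_i q^{2(k-l)}}` for `T ∈ ℬ₋(mϖ_i)` -/
def mTab (M N : ℕ) (q : ℂ) (i m : ℕ) (a : ℂ) (T : ℤ × ℤ → ℕ) : LW :=
  ∏ k ∈ Finset.Icc 1 i, ∏ l ∈ Finset.Icc 1 m,
    box M N q (T (-(k : ℤ), -(l : ℤ))) (a * tau M N q i * q ^ (2 * ((k : ℤ) - l)))

/-- the highest tableau `H ∈ ℬ₋(mϖ_i)`, `H(-k,-l) = i + 1 - k` -/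
def Htab (i m : ℕ) : ℤ × ℤ → ℕ := fun p =>
  if 1 ≤ -p.1 ∧ -p.1 ≤ (i : ℤ) ∧ 1 ≤ -p.2 ∧ -p.2 ≤ (m : ℤ) then i + 1 - (-p.1).toNat else 0

/-- `m_T = ∏_{(i,j) ∈ Y₋^λ} ⬜T(i,j)_{aq^{2(j-i)+1}}` for `T ∈ ℬ₋(λ)`, written as a
product over a bounding rectangle of the Young diagram -/
def mTgen (M N : ℕ) (q : ℂ) (lam : ℕ → ℕ) (a : ℂ) (T : ℤ × ℤ → ℕ) : LW :=
  ∏ k ∈ Finset.Icc 1 (M + lam (M + 1)), ∏ l ∈ Finset.Icc 1 (max (lam 1) N),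
    if (k, l) ∈ Yp M N lam then
      box M N q (T (-(k : ℤ), -(l : ℤ))) (a * q ^ (2 * ((k : ℤ) - l) + 1))
    else 1

/-- the normalization factor `f^{(i)}_{c,a}(z)` -/
def fRF (M N : ℕ) (q : ℂ) (i : ℕ) (c a : ℂ) : RatFunc ℂ :=
  if i ≤ M then 1 - Cc (a * q ^ ((M : ℤ) - N - i - 1)) * Z
  else (1 - Cc (a * (c ^ 2)⁻¹ * q ^ ((M : ℤ) + N - i - 1)) * Z) *
      (1 - Cc (a * q ^ ((i : ℤ) - M - N - 1)) * Z) /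
      (1 - Cc (a * q ^ ((M : ℤ) + N - i - 1)) * Z)


/-- the linear factor `1 - cz` -/
def linFactor (c : ℂ) : RatFunc ℂ := 1 - Cc c * Z

lemma linFactor_eq (c : ℂ) :
    linFactor c = algebraMap (Polynomial ℂ) (RatFunc ℂ) (1 - Polynomial.C c * Polynomial.X) := by
  simp [linFactor, Cc, Z, RatFunc.algebraMap_C, RatFunc.algebraMap_X]

lemma one_sub_C_mul_X_ne_zero (c : ℂ) :
    (1 - Polynomial.C c * Polynomial.X : Polynomial ℂ) ≠ 0 := fun h => by
  simpa using congrArg (Polynomial.eval 0) h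

lemma linFactor_ne_zero (c : ℂ) : linFactor c ≠ 0 := by
  rw [linFactor_eq]
  exact RatFunc.algebraMap_ne_zero (one_sub_C_mul_X_ne_zero c)

lemma eval_zero_ne_zero_of_dvd {p r : Polynomial ℂ} (h : p ∣ r) (hr : r.eval 0 ≠ 0) :
    p.eval 0 ≠ 0 := by
  obtain ⟨s, rfl⟩ := h
  rw [Polynomial.eval_mul] at hr
  exact left_ne_zero_of_mul hr

lemma eval_zero_denom_linFactor_div (c d : ℂ) :
    Polynomial.eval 0 (linFactor c / linFactor d).denom ≠ 0 := by
  rw [linFactor_eq, linFactor_eq]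
  exact eval_zero_ne_zero_of_dvd (RatFunc.denom_div_dvd _ _) (by simp)

lemma eval_zero_num_linFactor_div (c d : ℂ) :
    Polynomial.eval 0 (linFactor c / linFactor d).num ≠ 0 := by
  rw [linFactor_eq, linFactor_eq]
  exact eval_zero_ne_zero_of_dvd (RatFunc.num_div_dvd _ (one_sub_C_mul_X_ne_zero d)) (by simp)

lemma Psi_fst_of_le {M N : ℕ} {q : ℂ} {i : ℕ} (hi : i ≤ M) (a : ℂ) (k : ℕ) :
    (Psi M N q i a).1 k =
      if 1 ≤ k ∧ k ≤ i then linFactor (a * (tau M N q i)⁻¹) else 1 := by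
  simp [Psi, hi, linFactor]

lemma Psi_fst_of_lt {M N : ℕ} {q : ℂ} {i : ℕ} (hi : M < i) (a : ℂ) (k : ℕ) :
    (Psi M N q i a).1 k =
      if i < k ∧ k ≤ M + N then (linFactor (a * (tau M N q i)⁻¹))⁻¹ else 1 := by
  simp [Psi, hi.not_ge, linFactor]

lemma Psi_zero (M N : ℕ) (q a : ℂ) : Psi M N q 0 a = 1 := by
  refine Prod.ext (funext fun k => ?_) rfl
  rw [Psi_fst_of_le (Nat.zero_le M), if_neg (by omega)]
  rfl

lemma Psi_add (M : ℕ) {N : ℕ} (hN : 1 ≤ N) (q a : ℂ) : Psi M N q (M + N) a = 1 := by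
  refine Prod.ext (funext fun k => ?_) rfl
  rw [Psi_fst_of_lt (by omega), if_neg (by omega)]
  rfl

lemma prod_nbr_succ {G : Type*} [CommMonoid G] {M N m : ℕ} (hm : m + 1 < M + N) (F : ℕ → G)
    (h0 : F 0 = 1) (hκ : F (M + N) = 1) :
    ∏ j ∈ nbr M N (m + 1), F j = F m * F (m + 2) := by
  rw [← Finset.prod_pair (show m ≠ m + 2 by omega)]
  refine Finset.prod_subset (fun j hj => ?_) fun j hj hj' => ?_
  · simp only [nbr, Finset.mem_filter, Finset.mem_Icc] at hj
    simp only [Finset.mem_insert, Finset.mem_singleton]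
    omega
  · simp only [nbr, Finset.mem_filter, Finset.mem_Icc] at hj'
    simp only [Finset.mem_insert, Finset.mem_singleton] at hj
    obtain rfl | rfl : j = 0 ∨ j = M + N := by omega
    exacts [h0, hκ]

lemma tau_ne_zero (M N : ℕ) {q : ℂ} (hq : q ≠ 0) (i : ℕ) : tau M N q i ≠ 0 := by
  unfold tau
  split_ifs <;> exact zpow_ne_zero _ hq

lemma tau_succ_of_lt {M : ℕ} (N : ℕ) {q : ℂ} (hq : q ≠ 0) {i : ℕ} (hi : i < M) :
    tau M N q (i + 1) = tau M N q i * q⁻¹ := by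
  rw [tau, tau, if_pos (Nat.succ_le_of_lt hi), if_pos hi.le, ← zpow_sub_one₀ hq]
  congr 1
  push_cast
  ring

lemma tau_succ_of_le {M : ℕ} (N : ℕ) {q : ℂ} (hq : q ≠ 0) {i : ℕ} (hi : M ≤ i) :
    tau M N q (i + 1) = tau M N q i * q := by
  obtain rfl | hi := hi.eq_or_lt
  · rw [tau, tau, if_neg (by omega), if_pos le_rfl, ← zpow_add_one₀ hq]
    congr 1
    push_cast
    ring
  · rw [tau, tau, if_neg (by omega), if_neg (by omega), ← zpow_add_one₀ hq]
    congr 1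
    push_cast
    ring

lemma theta_of_le {M : ℕ} (N : ℕ) (q : ℂ) {i : ℕ} (hi : i ≤ M) :
    theta M N q i = tau M N q i ^ 2 := by
  rw [theta, tau, if_pos hi, if_pos hi, ← zpow_natCast, ← zpow_mul]
  congr 1
  push_cast
  ring

lemma theta_of_lt {M : ℕ} (N : ℕ) {q : ℂ} (hq : q ≠ 0) {i : ℕ} (hi : M < i) :
    theta M N q i = (tau M N q i * q⁻¹) ^ 2 := by
  rw [theta, tau, if_neg hi.not_ge, if_neg hi.not_ge, ← zpow_sub_one₀ hq, ← zpow_natCast,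
    ← zpow_mul]
  congr 1
  push_cast
  ring

lemma alphaPair_succ_right (M i : ℕ) : alphaPair M i (i + 1) = -sgn M (i + 1) := by
  simp [alphaPair, epsPair, show i ≠ i + 1 + 1 by omega]

lemma alphaPair_succ_left (M i : ℕ) : alphaPair M (i + 1) i = -sgn M (i + 1) := by
  simp [alphaPair, epsPair, show i + 1 + 1 ≠ i by omega]

lemma Amat_fst (M N : ℕ) (q : ℂ) (i : ℕ) (a : ℂ) (k : ℕ) :
    (Amat M N q i a).1 k =
      if k = i then
        Cc (qq M q i) *
          linFactor (a * tau M N q i * q⁻¹ * (theta M N q i)⁻¹ * (qq M q i)⁻¹) /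
          linFactor (a * tau M N q i * q⁻¹ * (theta M N q i)⁻¹ * qq M q i)
      else if k = i + 1 then
        Cc (qq M q (i + 1))⁻¹ *
          linFactor (a * tau M N q i * q⁻¹ * (theta M N q i)⁻¹ * qq M q i *
            qq M q (i + 1) ^ 2) /
          linFactor (a * tau M N q i * q⁻¹ * (theta M N q i)⁻¹ * qq M q i)
      else 1 := rfl

lemma qq_ne_zero (M : ℕ) {q : ℂ} (hq : q ≠ 0) (i : ℕ) : qq M q i ≠ 0 := by
  unfold qq
  split_ifs <;> simp [hq]

/-- the constants relating `A_{i,a}` to the product of prefundamental ℓ-weights -/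
def rootConst (M : ℕ) (q : ℂ) (i k : ℕ) : ℂ :=
  if k = i then qq M q i else if k = i + 1 then (qq M q (i + 1))⁻¹ else 1

lemma rootConst_ne_zero (M : ℕ) {q : ℂ} (hq : q ≠ 0) (i k : ℕ) : rootConst M q i k ≠ 0 := by
  unfold rootConst
  split_ifs <;> simp [qq_ne_zero M hq]

lemma lequiv_of_fst_eq {M N : ℕ} {q : ℂ} (hq : q ≠ 0) {f g : LW} (i : ℕ) (c d : ℂ)
    (hfg : ∀ k, 1 ≤ k → k ≤ M + N →
      f.1 k * (g.1 k)⁻¹ = linFactor c / linFactor d * Cc (rootConst M q i k)) :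
    lequiv M N f g :=
  ⟨_, eval_zero_denom_linFactor_div c d, eval_zero_num_linFactor_div c d, rootConst M q i,
    fun k hk hk' => ⟨rootConst_ne_zero M hq i k, hfg k hk hk'⟩⟩

lemma Cc_one : Cc 1 = 1 := map_one _

/-- `A_{i,a} ≡ (Ψ_{i,aq_i⁻²} Ψ_{i,aq̂_i²}⁻¹) ∏_{j∼i} Ψ_{j,aq_{ij}⁻¹} Ψ_{j,aq_{ij}}⁻¹`. -/
theorem statement8 (M N : ℕ) (hM : 1 ≤ M) (hN : 1 ≤ N) (q : ℂ) (hq : q ≠ 0)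
    (hroot : ∀ n : ℕ, 0 < n → q ^ n ≠ 1) (i : ℕ) (hi : 1 ≤ i) (hi' : i ≤ M + N - 1)
    (a : ℂ) (ha : a ≠ 0) :
    lequiv M N (Amat M N q i a)
      (Psi M N q i (a * qq M q i ^ (-2 : ℤ)) * (Psi M N q i (a * qhat M q i ^ 2))⁻¹ *
        ∏ j ∈ nbr M N i,
          Psi M N q j (a * (q ^ alphaPair M i j)⁻¹) *
            (Psi M N q j (a * q ^ alphaPair M i j))⁻¹) := by
  obtain ⟨m, rfl⟩ : ∃ m, i = m + 1 := ⟨i - 1, by omega⟩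
  rw [prod_nbr_succ (by omega) _ (by simp [Psi_zero]) (by simp [Psi_add M hN]),
    alphaPair_succ_left, alphaPair_succ_right]
  have ht := tau_ne_zero M N hq m
  rcases lt_trichotomy (m + 1) M with h | h | h
  · refine lequiv_of_fst_eq hq (m + 1) 0 0 fun k hk hk' => ?_
    simp only [Prod.fst_mul, Pi.mul_apply, Prod.fst_inv, Pi.inv_apply, Amat_fst, qhat, qq, sgn,
      rootConst, if_pos h.le, if_neg h.ne, if_pos (show m + 1 + 1 ≤ M by omega)]
    simp only [Psi_fst_of_le (show m ≤ M by omega),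
      Psi_fst_of_le (show m + 1 ≤ M by omega), Psi_fst_of_le (show m + 2 ≤ M by omega)]
    rw [theta_of_le N q h.le, tau_succ_of_lt N hq h, tau_succ_of_lt N hq (show m < M by omega)]
    generalize tau M N q m = t at *
    split_ifs <;> first | omega | skip
    all_goals simp [Cc_one]
    all_goals field_simp [linFactor_ne_zero]
  · refine lequiv_of_fst_eq hq (m + 1) (a * (tau M N q m)⁻¹ * q⁻¹) (a * (tau M N q m)⁻¹ * q) fun k hk hk' => ?_
    simp only [Prod.fst_mul, Pi.mul_apply, Prod.fst_inv, Pi.inv_apply, Amat_fst, qhat, qq, sgn,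
      rootConst, if_pos h.le, if_pos h, if_neg (show ¬m + 1 + 1 ≤ M by omega)]
    simp only [Psi_fst_of_le (show m ≤ M by omega),
      Psi_fst_of_le (show m + 1 ≤ M by omega), Psi_fst_of_lt (show M < m + 2 by omega)]
    rw [theta_of_le N q h.le, tau_succ_of_le N hq h.ge, tau_succ_of_lt N hq (show m < M by omega)]
    generalize tau M N q m = t at *
    split_ifs <;> first | omega | skip
    all_goals simp [Cc_one]
    all_goals field_simp [linFactor_ne_zero]
  · have hs : ¬m + 1 + 1 ≤ M := by omega
    obtain rfl | hm := (Nat.lt_succ_iff.1 h).eq_or_lt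
    · refine lequiv_of_fst_eq hq (M + 1) (a * (tau M N q M)⁻¹ * q) (a * (tau M N q M)⁻¹ * q⁻¹) fun k hk hk' => ?_
      simp only [Prod.fst_mul, Pi.mul_apply, Prod.fst_inv, Pi.inv_apply, Amat_fst, qhat, qq, sgn,
        rootConst, if_neg h.not_ge, if_neg h.ne', if_neg hs]
      simp only [Psi_fst_of_le (le_refl M),
        Psi_fst_of_lt (show M < M + 1 by omega), Psi_fst_of_lt (show M < M + 2 by omega)]
      rw [theta_of_lt N hq h, tau_succ_of_le N hq h.le, tau_succ_of_le N hq le_rfl]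
      generalize tau M N q M = t at *
      split_ifs <;> first | omega | skip
      all_goals simp [Cc_one]
      all_goals field_simp [linFactor_ne_zero]
    · refine lequiv_of_fst_eq hq (m + 1) 0 0 fun k hk hk' => ?_
      simp only [Prod.fst_mul, Pi.mul_apply, Prod.fst_inv, Pi.inv_apply, Amat_fst, qhat, qq, sgn,
        rootConst, if_neg h.not_ge, if_neg h.ne', if_neg hs]
      simp only [Psi_fst_of_lt (show M < m by omega),
        Psi_fst_of_lt (show M < m + 1 by omega), Psi_fst_of_lt (show M < m + 2 by omega)]
      rw [theta_of_lt N hq h, tau_succ_of_le N hq h.le, tau_succ_of_le N hq hm.le]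
      generalize tau M N q m = t at *
      split_ifs <;> first | omega | skip
      all_goals simp [Cc_one]
      all_goals field_simp [linFactor_ne_zero]

end QAS
end
end
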